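/- For every λ > 0, the truncated-Poisson stock-out probability is discretely convex in the base-stock position: P(λ, S) + P(λ, S+2) ≥ 2 · P(λ, S+1) for every S ∈ ℕ (equivalently, the forward differences P(λ, S+1) − P(λ, S) are nondecreasing in S). -/

import Mathlib

/-- Truncated-Poisson stock-out probability
`P(λ, S) = (λ^S / S!) / (∑_{s=0}^{S} λ^s / s!)`. -/
noncomputable def stockout (lam : ℝ) (S : ℕ) : ℝ :=
  (lam ^ S / (Nat.factorial S : ℝ)) /
    (∑ s ∈ Finset.range (S + 1), lam ^ s / (Nat.factorial s : ℝ))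

theorem stockout_pos {lam : ℝ} (hlam : 0 < lam) (S : ℕ) : 0 < stockout lam S := by
  unfold stockout
  have : 0 < ∑ s ∈ Finset.range (S + 1), lam ^ s / (Nat.factorial s : ℝ) :=
    Finset.sum_pos (fun _ _ => by positivity) (by simp)
  positivity

/-- The Erlang recursion for the stock-out probability. -/
theorem stockout_succ {lam : ℝ} (hlam : 0 < lam) (S : ℕ) :
    stockout lam (S + 1) = lam * stockout lam S / (S + 1 + lam * stockout lam S) := by
  unfold stockout
  rw [Finset.sum_range_succ _ (S + 1)]
  have hZ : 0 < ∑ s ∈ Finset.range (S + 1), lam ^ s / (Nat.factorial s : ℝ) :=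
    Finset.sum_pos (fun _ _ => by positivity) (by simp)
  generalize ∑ s ∈ Finset.range (S + 1), lam ^ s / (Nat.factorial s : ℝ) = Z at hZ ⊢
  have hf : (0 : ℝ) < Nat.factorial S := by positivity
  rw [Nat.factorial_succ]
  push_cast
  field_simp
  ring

/-- One step of the recursion `v = a m / (m + a - u)` for the carried load preserves the
quadratic bound. -/
theorem carriedLoad_bound_step {a m u v : ℝ} (ha : 0 < a) (hm : 0 < m) (hu : u < m)
    (hv : v * (m + a - u) = a * m)
    (h : 0 ≤ (m - 1) * (m + a) - u * (3 * m - 1 + a) + 2 * u ^ 2) :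
    v < m + 1 ∧ 0 ≤ m * (m + 1 + a) - v * (3 * m + 2 + a) + 2 * v ^ 2 := by
  obtain ⟨t, rfl⟩ : ∃ t, u = m - t := ⟨m - u, by ring⟩
  have ht : 0 < t := by linarith
  have hD : 0 < a + t := by linarith
  have hv' : v = a * m / (a + t) := by
    rw [eq_div_iff hD.ne', ← hv]; ring
  have hk : a ≤ 2 * t ^ 2 + (a - m - 1) * t := by linarith
  have hL : a * (a - m - 1) ≤ t * ((a - m - 1) ^ 2 + 2 * a) := by
    generalize a - m - 1 = p at hk ⊢
    by_contra! hlt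
    have hp : 0 < p := by
      by_contra! hp
      nlinarith [mul_nonneg ha.le (neg_nonneg.2 hp), mul_nonneg ht.le (sq_nonneg p),
        mul_pos ht ha]
    have h1 := mul_le_mul_of_nonneg_left hk hp.le
    have h2 : a < p * t := by
      by_contra! h2
      nlinarith [mul_le_mul_of_nonneg_left h2 ht.le]
    nlinarith [mul_lt_mul_of_pos_left h2 hp, mul_pos ht ha]
  constructor
  · rw [hv', div_lt_iff₀ hD]
    nlinarith [mul_pos hm ht]
  · have key : 0 ≤ (m + 1 + a) * (a + t) ^ 2 - a * (a + t) * (3 * m + 2 + a)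
        + 2 * a ^ 2 * m := by
      have := mul_nonneg (by linarith : 0 ≤ m + 1 + a) (sub_nonneg.2 hk)
      linarith
    have : m * (m + 1 + a) - v * (3 * m + 2 + a) + 2 * v ^ 2 =
        m * ((m + 1 + a) * (a + t) ^ 2 - a * (a + t) * (3 * m + 2 + a) + 2 * a ^ 2 * m)
          / (a + t) ^ 2 := by
      rw [hv']; field_simp
    rw [this]
    positivity

theorem carriedLoad_succ {lam : ℝ} (hlam : 0 < lam) (S : ℕ) :
    lam * (1 - stockout lam (S + 1)) * ((S : ℝ) + 1 + lam - lam * (1 - stockout lam S))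
      = lam * (S + 1) := by
  have hD : 0 < (S : ℝ) + 1 + lam * stockout lam S := by
    have := stockout_pos hlam S
    positivity
  rw [stockout_succ hlam]
  field_simp
  ring

theorem carriedLoad_bound {lam : ℝ} (hlam : 0 < lam) (n : ℕ) :
    lam * (1 - stockout lam n) < n + 1 ∧
      0 ≤ (n : ℝ) * (n + 1 + lam) - lam * (1 - stockout lam n) * (3 * n + 2 + lam)
        + 2 * (lam * (1 - stockout lam n)) ^ 2 := by
  induction n with
  | zero => simp [stockout]
  | succ n ih =>
    push_cast
    refine carriedLoad_bound_step hlam (by positivity) ih.1 (carriedLoad_succ hlam n) ?_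
    linarith [ih.2]

theorem stmt_4 (lam : ℝ) (hlam : 0 < lam) (S : ℕ) :
    2 * stockout lam (S + 1) ≤ stockout lam S + stockout lam (S + 2) := by
  have hb := stockout_pos hlam S
  have hc := stockout_pos hlam (S + 1)
  have hrec := carriedLoad_succ hlam S
  have hbound := (carriedLoad_bound hlam (S + 1)).2
  have h1 := stockout_succ hlam S
  have h2 := stockout_succ hlam (S + 1)
  rw [show S + 1 + 1 = S + 2 from rfl] at h2
  push_cast at h2 hbound
  rw [h2]
  generalize stockout lam (S + 1) = c at *
  generalize stockout lam S = b at *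
  have hn : (0 : ℝ) < S + 1 := by positivity
  generalize (S : ℝ) + 1 = n at *
  have hu : 0 < lam * (1 - c) := by
    refine pos_of_mul_pos_left (b := n + lam - lam * (1 - b)) ?_ ?_
    · rw [hrec]; positivity
    · nlinarith [mul_pos hlam hb]
  have hb' : b = n * c / (lam * (1 - c)) := by
    rw [eq_div_iff hu.ne']
    rw [eq_div_iff (by positivity)] at h1
    linarith
  have hE : 0 < n + 1 + lam * c := by positivity
  have hdiff : b + lam * c / (n + 1 + lam * c) - 2 * c =
      c * (n * (n + 1 + lam) - lam * (1 - c) * (3 * n + 2 + lam) + 2 * (lam * (1 - c)) ^ 2)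
        / (lam * (1 - c) * (n + 1 + lam * c)) := by
    rw [hb']
    have hc1 : 1 - c ≠ 0 := (pos_of_mul_pos_right hu hlam.le).ne'
    field_simp
    ring
  have : 0 ≤ b + lam * c / (n + 1 + lam * c) - 2 * c := by
    rw [hdiff]
    exact div_nonneg (mul_nonneg hc.le hbound) (mul_pos hu hE).le
  linarith
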